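/- arXiv:2407.20991 — 2 statements merged into one kernel-verified Lean document; each statement's English description precedes it below -/
import Mathlib

section
/- Let j ∈ ℂ with Re j > −1, let k ∈ ℕ, and let τ > 0. Then lim_{ε→0⁺} ∫_0^∞ e^{iξτ − εξ} ξ^j (log ξ)^k dξ = τ^{−j−1} · Σ_{κ=0}^{k} c_{j,k,κ} (log τ)^κ, where c_{j,k,κ} := e^{iπ(j+1)/2} (−1)^κ binom(k,κ) Σ_{m=0}^{k−κ} (iπ/2)^{k−κ−m} binom(k−κ,m) Γ^{(m)}(j+1). -/
open MeasureTheory Filter Set Topology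

/-- `∫₀^∞ t^(s-1) e^(-wt) dt` is holomorphic in `w` on the right half-plane. -/
lemma differentiableAt_integral_cpow_mul_exp_neg_mul {s w₀ : ℂ} (hs : 0 < s.re) (hw₀ : 0 < w₀.re) :
    DifferentiableAt ℂ
      (fun w : ℂ => ∫ t in Ioi (0 : ℝ), (t : ℂ) ^ (s - 1) * Complex.exp (-(w * t))) w₀ := by
  have hcpow : ContinuousOn (fun t : ℝ => (t : ℂ) ^ (s - 1)) (Ioi 0) := fun t ht =>
    (Complex.continuousAt_ofReal_cpow_const _ _ (Or.inr (ne_of_gt ht))).continuousWithinAt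
  have hmeas : ∀ w : ℂ, AEStronglyMeasurable
      (fun t : ℝ => (t : ℂ) ^ (s - 1) * Complex.exp (-(w * t))) (volume.restrict (Ioi 0)) :=
    fun w => (hcpow.mul (by fun_prop)).aestronglyMeasurable measurableSet_Ioi
  have hnorm : ∀ (w : ℂ) (t : ℝ), 0 < t →
      ‖(t : ℂ) ^ (s - 1) * Complex.exp (-(w * t))‖ =
        t ^ (s.re - 1) * Real.exp (-w.re * t) := by
    intro w t ht
    rw [norm_mul, Complex.norm_cpow_eq_rpow_re_of_pos ht, Complex.norm_exp]
    simp
  have hint : ∀ {p b : ℝ}, -1 < p → 0 < b →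
      IntegrableOn (fun t : ℝ => t ^ p * Real.exp (-b * t)) (Ioi 0) := by
    intro p b hp hb
    simpa using integrableOn_rpow_mul_exp_neg_mul_rpow hp one_pos hb
  refine (hasDerivAt_integral_of_dominated_loc_of_deriv_le
    (F := fun (w : ℂ) (t : ℝ) => (t : ℂ) ^ (s - 1) * Complex.exp (-(w * t)))
    (F' := fun (w : ℂ) (t : ℝ) => (t : ℂ) ^ (s - 1) * Complex.exp (-(w * t)) * (-t))
    (bound := fun t : ℝ => t ^ s.re * Real.exp (-(w₀.re / 2) * t))
    (s := {w : ℂ | w₀.re / 2 < w.re}) ?_ ?_ ?_ ?_ ?_ ?_ ?_).2.differentiableAt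
  · exact (isOpen_lt continuous_const Complex.continuous_re).mem_nhds (half_lt_self hw₀)
  · exact Eventually.of_forall hmeas
  · refine (hint (p := s.re - 1) (by linarith) hw₀).mono' (hmeas w₀) ?_
    filter_upwards [ae_restrict_mem measurableSet_Ioi] with t ht
    exact (hnorm w₀ t ht).le
  · exact (hmeas w₀).mul (by fun_prop)
  · filter_upwards [ae_restrict_mem measurableSet_Ioi] with t ht w hw
    have ht' : (0 : ℝ) < t := ht
    rw [norm_mul, hnorm w t ht, norm_neg, Complex.norm_real, Real.norm_of_nonneg ht'.le,
      mul_right_comm, ← Real.rpow_add_one ht'.ne', sub_add_cancel]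
    have : w₀.re / 2 < w.re := hw
    gcongr
  · exact hint (by linarith) (half_pos hw₀)
  · refine Eventually.of_forall fun t w _ => ?_
    have h : HasDerivAt (fun w : ℂ => -(w * t)) (-(t : ℂ)) w := by
      simpa only [id, one_mul] using! ((hasDerivAt_id w).mul_const (t : ℂ)).neg
    simpa [mul_assoc] using h.cexp.const_mul ((t : ℂ) ^ (s - 1))

/-- The Gamma integral with a complex rate in the right half-plane. -/
lemma integral_cpow_mul_exp_neg_mul_of_re_pos {s w : ℂ} (hs : 0 < s.re) (hw : 0 < w.re) :
    ∫ t in Ioi (0 : ℝ), (t : ℂ) ^ (s - 1) * Complex.exp (-(w * t)) =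
      Complex.Gamma s * Complex.exp (-Complex.log w * s) := by
  have hopen : IsOpen {w : ℂ | 0 < w.re} := isOpen_lt continuous_const Complex.continuous_re
  have hl : AnalyticOnNhd ℂ (fun w : ℂ =>
      ∫ t in Ioi (0 : ℝ), (t : ℂ) ^ (s - 1) * Complex.exp (-(w * t))) {w : ℂ | 0 < w.re} :=
    DifferentiableOn.analyticOnNhd (fun w hw =>
      (differentiableAt_integral_cpow_mul_exp_neg_mul hs hw).differentiableWithinAt) hopen
  have hr : AnalyticOnNhd ℂ (fun w : ℂ =>
      Complex.Gamma s * Complex.exp (-Complex.log w * s)) {w : ℂ | 0 < w.re} := by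
    refine DifferentiableOn.analyticOnNhd (fun w hw => ?_) hopen
    have := Complex.differentiableAt_log (z := w) (Or.inl hw)
    exact DifferentiableAt.differentiableWithinAt (by fun_prop)
  refine hl.eqOn_of_preconnected_of_frequently_eq hr
    (convex_halfSpace_re_gt 0).isPreconnected (z₀ := 1) (by simp) ?_ hw
  have hreal : ∀ᶠ r : ℝ in 𝓝[≠] 1,
      ∫ t in Ioi (0 : ℝ), (t : ℂ) ^ (s - 1) * Complex.exp (-((r : ℂ) * t)) =
        Complex.Gamma s * Complex.exp (-Complex.log r * s) := by
    filter_upwards [nhdsWithin_le_nhds (Ioi_mem_nhds one_pos)] with r hr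
    have hr' : (0 : ℝ) < r := hr
    rw [Complex.integral_cpow_mul_exp_neg_mul_Ioi hs hr', mul_comm, one_div,
      Complex.cpow_def_of_ne_zero (by simpa using hr'.ne'), Complex.log_inv]
    rw [Complex.arg_ofReal_of_nonneg hr'.le]
    exact Real.pi_pos.ne
  have htend : Tendsto (fun r : ℝ => (r : ℂ)) (𝓝[≠] 1) (𝓝[≠] 1) := by
    refine tendsto_nhdsWithin_iff.2 ⟨?_, ?_⟩
    · simpa using (Complex.continuous_ofReal.tendsto 1).mono_left nhdsWithin_le_nhds
    · filter_upwards [self_mem_nhdsWithin] with r hr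
      simpa using hr
  exact htend.frequently hreal.frequently

/-- The Mellin transform of `(log t)^k e^(-wt)` is the `k`-th derivative of `Γ(s) w^(-s)`. -/
lemma mellin_log_pow_smul_exp_neg_mul {w : ℂ} (hw : 0 < w.re) (k : ℕ) {s : ℂ} (hs : 0 < s.re) :
    mellin (fun t : ℝ => Real.log t ^ k • Complex.exp (-(w * t))) s =
      iteratedDeriv k (fun z => Complex.Gamma z * Complex.exp (-Complex.log w * z)) s := by
  have htop : ∀ (k : ℕ) (a : ℝ),
      (fun t : ℝ => Real.log t ^ k • Complex.exp (-(w * t))) =O[atTop] (· ^ (-a)) := by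
    intro k
    induction k with
    | zero =>
      intro a
      refine (Asymptotics.IsBigO.of_bound 1 (Eventually.of_forall fun t => ?_)).trans
        (isLittleO_exp_neg_mul_rpow_atTop hw (-a)).isBigO
      simp [Complex.norm_exp]
    | succ k ih =>
      intro a
      simpa only [pow_succ', mul_smul] using isBigO_rpow_top_log_smul (lt_add_one a) (ih (a + 1))
  have hbot : ∀ (k : ℕ) (b : ℝ), 0 < b →
      (fun t : ℝ => Real.log t ^ k • Complex.exp (-(w * t))) =O[𝓝[>] 0] (· ^ (-b)) := by
    have hzero : (fun t : ℝ => Real.log t ^ 0 • Complex.exp (-(w * t))) =O[𝓝[>] 0]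
        (· ^ (-(0 : ℝ))) := by
      have hc : Continuous fun t : ℝ => Complex.exp (-(w * t)) := by fun_prop
      simpa using ((hc.tendsto 0).mono_left nhdsWithin_le_nhds).isBigO_one ℝ
    intro k
    induction k with
    | zero =>
      intro b hb
      refine hzero.trans ?_
      refine Asymptotics.IsBigO.of_bound 1 ?_
      filter_upwards [Ioc_mem_nhdsGT one_pos] with t ht
      rw [one_mul, Real.norm_of_nonneg (by have := ht.1; positivity),
        Real.norm_of_nonneg (by have := ht.1; positivity)]
      exact Real.rpow_le_rpow_of_exponent_ge ht.1 ht.2 (by linarith)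
    | succ k ih =>
      intro b hb
      simpa only [pow_succ', mul_smul] using
        isBigO_rpow_zero_log_smul (half_lt_self hb) (ih (b / 2) (half_pos hb))
  have hloc : ∀ k : ℕ, LocallyIntegrableOn
      (fun t : ℝ => Real.log t ^ k • Complex.exp (-(w * t))) (Ioi 0) := by
    intro k
    refine ContinuousOn.locallyIntegrableOn ?_ measurableSet_Ioi
    have hlog : ContinuousOn Real.log (Ioi 0) :=
      Real.continuousOn_log.mono fun t ht => ne_of_gt ht
    exact (hlog.pow k).smul (by fun_prop)
  induction k generalizing s with
  | zero =>
    simpa [mellin] using integral_cpow_mul_exp_neg_mul_of_re_pos hs hw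
  | succ k ih =>
    have hderiv := (mellin_hasDerivAt_of_isBigO_rpow (hloc k) (htop k (s.re + 1))
      (lt_add_one _) (hbot k (s.re / 2) (half_pos hs)) (half_lt_self hs)).2.deriv
    simp only [pow_succ', mul_smul]
    rw [← hderiv, iteratedDeriv_succ]
    refine Filter.EventuallyEq.deriv_eq ?_
    filter_upwards [(isOpen_lt continuous_const Complex.continuous_re).mem_nhds hs] with z hz
    exact ih hz

/-- Leibniz expansion of the `k`-th derivative of `Γ(s) e^(cs)`. -/
lemma iteratedDeriv_Gamma_mul_exp {s : ℂ} (hs : 0 < s.re) (c : ℂ) (k : ℕ) :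
    iteratedDeriv k (fun z => Complex.Gamma z * Complex.exp (c * z)) s =
      Complex.exp (c * s) * ∑ m ∈ Finset.range (k + 1),
        k.choose m * iteratedDeriv m Complex.Gamma s * c ^ (k - m) := by
  have hopen : IsOpen {w : ℂ | 0 < w.re} := isOpen_lt continuous_const Complex.continuous_re
  have hΓ : DifferentiableOn ℂ Complex.Gamma {w : ℂ | 0 < w.re} := fun z hz =>
    (Complex.differentiableAt_Gamma z fun m h => by
      have hz' : 0 < z.re := hz
      rw [h] at hz'
      simp only [Complex.neg_re, Complex.natCast_re] at hz'
      linarith [Nat.cast_nonneg (α := ℝ) m]).differentiableWithinAt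
  rw [iteratedDeriv_fun_mul (hΓ.analyticOnNhd hopen s hs).contDiffAt (by fun_prop),
    Finset.mul_sum]
  refine Finset.sum_congr rfl fun m _ => ?_
  rw [iteratedDeriv_cexp_const_mul]
  ring

/-- Binomial expansion of `(a - l)^(k-m)` in a binomial convolution, sorted by powers of `l`. -/
lemma sum_choose_mul_sub_pow (G : ℕ → ℂ) (a l : ℂ) (k : ℕ) :
    ∑ m ∈ Finset.range (k + 1), k.choose m * G m * (a - l) ^ (k - m) =
      ∑ κ ∈ Finset.range (k + 1), ((-1) ^ κ * (k.choose κ) *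
        ∑ m ∈ Finset.range (k - κ + 1), a ^ (k - κ - m) * ((k - κ).choose m) * G m) * l ^ κ := by
  have hpow : ∀ n : ℕ, (a - l) ^ n =
      ∑ κ ∈ Finset.range (n + 1), (-l) ^ κ * a ^ (n - κ) * n.choose κ := by
    intro n
    rw [← add_pow, neg_add_eq_sub]
  simp only [hpow, Finset.mul_sum, Finset.sum_mul]
  rw [Finset.sum_comm' (t' := Finset.range (k + 1))
    (s' := fun κ => Finset.range (k - κ + 1)) (by intro x y; simp only [Finset.mem_range]; omega)]
  refine Finset.sum_congr rfl fun κ _ => Finset.sum_congr rfl fun m _ => ?_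
  have hchoose : k.choose m * (k - m).choose κ = k.choose κ * (k - κ).choose m := by
    have h₁ := Nat.choose_mul (n := k) (Nat.le_add_right κ m)
    have h₂ := Nat.choose_mul (n := k) (Nat.le_add_left m κ)
    rw [Nat.add_sub_cancel_left] at h₁
    rw [Nat.add_sub_cancel] at h₂
    rw [← h₁, ← h₂, Nat.choose_symm_add]
  have hcast : (k.choose m : ℂ) * (k - m).choose κ = k.choose κ * (k - κ).choose m := by
    exact_mod_cast hchoose
  rw [Nat.sub_right_comm k κ m, neg_pow l]
  linear_combination G m * (-1) ^ κ * l ^ κ * a ^ (k - m - κ) * hcast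

/-- For `j ∈ ℂ` with `Re j > -1`, `k ∈ ℕ`, and `τ > 0`,
`lim_{ε→0⁺} ∫_0^∞ e^{iξτ - εξ} ξ^j (log ξ)^k dξ = τ^{-j-1} ∑_{κ=0}^k c_{j,k,κ} (log τ)^κ`,
where `c_{j,k,κ} = e^{iπ(j+1)/2} (-1)^κ C(k,κ) ∑_{m=0}^{k-κ} (iπ/2)^{k-κ-m} C(k-κ,m) Γ^{(m)}(j+1)`. -/
theorem stmt1 (j : ℂ) (hj : -1 < j.re) (k : ℕ) (τ : ℝ) (hτ : 0 < τ) :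
    Tendsto
      (fun ε : ℝ => ∫ ξ in Ioi (0 : ℝ),
        Complex.exp (Complex.I * ξ * τ - ε * ξ) * Complex.exp (j * Real.log ξ) *
          (Real.log ξ : ℂ) ^ k)
      (𝓝[>] 0)
      (𝓝 (Complex.exp (-(j + 1) * Real.log τ) *
        ∑ κ ∈ Finset.range (k + 1),
          (Complex.exp (Complex.I * Real.pi * (j + 1) / 2) * (-1) ^ κ * (k.choose κ) *
            ∑ m ∈ Finset.range (k - κ + 1),
              (Complex.I * Real.pi / 2) ^ (k - κ - m) * ((k - κ).choose m) *
                iteratedDeriv m Complex.Gamma (j + 1)) *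
            (Real.log τ : ℂ) ^ κ)) := by

  set s : ℂ := j + 1 with hs_def
  have hs : 0 < s.re := by simp [hs_def]; linarith
  set Φ : ℂ → ℂ := fun c => Complex.exp (c * s) * ∑ m ∈ Finset.range (k + 1),
    k.choose m * iteratedDeriv m Complex.Gamma s * c ^ (k - m) with hΦ
  have hΦc : Continuous Φ := by fun_prop
  have hintegral : ∀ ε : ℝ, 0 < ε →
      ∫ ξ in Ioi (0 : ℝ), Complex.exp (Complex.I * ξ * τ - ε * ξ) *
        Complex.exp (j * Real.log ξ) * (Real.log ξ : ℂ) ^ k =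
      Φ (-Complex.log (ε - Complex.I * τ)) := by
    intro ε hε
    have hw : 0 < ((ε : ℂ) - Complex.I * τ).re := by simpa using hε
    simp only [hΦ]
    rw [← iteratedDeriv_Gamma_mul_exp hs, ← mellin_log_pow_smul_exp_neg_mul hw k hs, mellin]
    refine setIntegral_congr_fun measurableSet_Ioi fun ξ hξ => ?_
    have hξ' : (0 : ℝ) < ξ := hξ
    simp only [smul_eq_mul, Complex.real_smul, Complex.ofReal_pow]
    rw [Complex.cpow_def_of_ne_zero (by exact_mod_cast hξ'.ne'), ← Complex.ofReal_log hξ'.le,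
      hs_def, add_sub_cancel_right, mul_comm (Real.log ξ : ℂ) j,
      show -(((ε : ℂ) - Complex.I * τ) * ξ) = Complex.I * ξ * τ - ε * ξ by ring]
    ring
  have hlog : Complex.log (-Complex.I * τ) = Real.log τ - Complex.I * Real.pi / 2 := by
    rw [mul_comm, Complex.log_ofReal_mul hτ (by simp), Complex.log_neg_I]
    ring
  have hlim : Tendsto (fun ε : ℝ => -Complex.log (ε - Complex.I * τ)) (𝓝[>] 0)
      (𝓝 (Complex.I * Real.pi / 2 - Real.log τ)) := by
    have hc : ContinuousAt (fun ε : ℝ => -Complex.log (ε - Complex.I * τ)) 0 := by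
      refine (ContinuousAt.clog (by fun_prop) (Or.inr ?_)).neg
      simpa using hτ.ne'
    have := hc.tendsto.mono_left (nhdsWithin_le_nhds (s := Ioi 0))
    rwa [Complex.ofReal_zero, zero_sub, ← neg_mul, hlog, neg_sub] at this
  have hmain := ((hΦc.tendsto _).comp hlim).congr' (f₂ := fun ε : ℝ => ∫ ξ in Ioi (0 : ℝ),
      Complex.exp (Complex.I * ξ * τ - ε * ξ) * Complex.exp (j * Real.log ξ) *
        (Real.log ξ : ℂ) ^ k) (by
    filter_upwards [self_mem_nhdsWithin] with ε hε
    exact (hintegral ε hε).symm)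
  convert hmain using 2
  simp only [hΦ]
  rw [sum_choose_mul_sub_pow, show (Complex.I * Real.pi / 2 - Real.log τ) * s =
    -s * Real.log τ + Complex.I * Real.pi * s / 2 by ring, Complex.exp_add,
    mul_assoc (Complex.exp _), Finset.mul_sum (a := Complex.exp (Complex.I * Real.pi * s / 2))]
  congr 1
  refine Finset.sum_congr rfl fun κ _ => ?_
  ring
end

section
/- Let σ₀ > 0, let φ be a Schwartz function on ℝ vanishing identically on (−∞, σ₀], and let ψ ∈ C_c^∞(ℝ) be identically 1 on a neighborhood of 0 with support contained in (−σ₀, σ₀). Then for every K ∈ ℕ and every r₀ > 0 there exists C > 0 such that for all t > 0 and all r ≥ r₀: |∫_0^∞ e^{i(σ²t − σr)} (1 − ψ(σ − r/(2t))) φ(σ) dσ| ≤ C (1 + t + r)^{−K}. -/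
open MeasureTheory Filter Set Topology

/-- Smooth bounded functions with compactly supported derivative, vanishing on `(-δ, δ)`. -/
structure IsCutoffAway (δ : ℝ) (u : ℝ → ℂ) : Prop where
  contDiff : ContDiff ℝ (⊤ : ℕ∞) u
  bounded : ∃ C, ∀ x, ‖u x‖ ≤ C
  compact_deriv : HasCompactSupport (deriv u)
  vanish : ∀ x, |x| < δ → u x = 0

theorem IsCutoffAway.deriv {δ : ℝ} {u : ℝ → ℂ} (hu : IsCutoffAway δ u) :
    IsCutoffAway δ (deriv u) where
  contDiff := (contDiff_infty_iff_deriv.1 hu.contDiff).2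
  bounded := hu.compact_deriv.exists_bound_of_continuous
    (contDiff_infty_iff_deriv.1 hu.contDiff).2.continuous
  compact_deriv := hu.compact_deriv.deriv
  vanish x hx := by
    have h : u =ᶠ[𝓝 x] fun _ => 0 := by
      filter_upwards [(isOpen_lt continuous_abs continuous_const).mem_nhds hx] with y hy
      exact hu.vanish y hy
    rw [h.deriv_eq, deriv_const]

theorem IsCutoffAway.hasDerivAt_inv_pow_mul {δ : ℝ} {u : ℝ → ℂ} (hδ : 0 < δ)
    (hu : IsCutoffAway δ u) (m : ℕ) (x : ℝ) :
    HasDerivAt (fun y : ℝ => (y : ℂ)⁻¹ ^ m * u y)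
      (-m * ((x : ℂ)⁻¹ ^ (m + 1) * u x) + (x : ℂ)⁻¹ ^ m * _root_.deriv u x) x := by
  rcases eq_or_ne x 0 with rfl | hx
  · have h0 : |(0 : ℝ)| < δ := by simpa using hδ
    rw [hu.vanish 0 h0, hu.deriv.vanish 0 h0]
    have h : (fun y : ℝ => (y : ℂ)⁻¹ ^ m * u y) =ᶠ[𝓝 0] fun _ => 0 := by
      filter_upwards [(isOpen_lt continuous_abs continuous_const).mem_nhds h0] with y hy
      rw [hu.vanish y hy, mul_zero]
    simpa using (hasDerivAt_const (0 : ℝ) (0 : ℂ)).congr_of_eventuallyEq h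
  · have hx' : (x : ℂ) ≠ 0 := by exact_mod_cast hx
    have h1 : HasDerivAt (fun y : ℝ => (y : ℂ)⁻¹) (-((x : ℂ) ^ 2)⁻¹) x :=
      (hasDerivAt_inv hx').comp_ofReal
    have h2 := (h1.pow m).mul
      ((hu.contDiff.differentiable (by simp)) x).hasDerivAt
    refine h2.congr_deriv ?_
    rcases m with _ | m
    · simp
    · simp only [Pi.pow_apply, Nat.add_sub_cancel]
      push_cast
      ring

theorem IsCutoffAway.norm_inv_pow_mul_le {δ : ℝ} {u : ℝ → ℂ} (hδ : 0 < δ)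
    (hu : IsCutoffAway δ u) (m : ℕ) :
    ∃ C, 0 ≤ C ∧ ∀ x : ℝ, ‖(x : ℂ)⁻¹ ^ m * u x‖ ≤ C := by
  obtain ⟨C, hC⟩ := hu.bounded
  have hC0 : 0 ≤ C := (norm_nonneg _).trans (hC 0)
  refine ⟨δ⁻¹ ^ m * C, by positivity, fun x => ?_⟩
  rcases lt_or_ge |x| δ with hx | hx
  · rw [hu.vanish x hx, mul_zero, norm_zero]
    positivity
  · rw [norm_mul, norm_pow, norm_inv, Complex.norm_real, Real.norm_eq_abs]
    have : |x|⁻¹ ≤ δ⁻¹ := inv_anti₀ hδ hx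
    gcongr
    exact hC x

/-- The oscillatory factor `e^{i(σ²t - σr)}`. -/
noncomputable def quadraticPhase (t r σ : ℝ) : ℂ :=
  Complex.exp (Complex.I * (σ ^ 2 * t - σ * r))

theorem norm_quadraticPhase (t r σ : ℝ) : ‖quadraticPhase t r σ‖ = 1 := by
  have h := Complex.norm_exp_ofReal_mul_I (σ ^ 2 * t - σ * r)
  push_cast at h
  rwa [mul_comm] at h

theorem hasDerivAt_quadraticPhase {t : ℝ} (ht : 0 < t) (r σ : ℝ) :
    HasDerivAt (quadraticPhase t r)
      (quadraticPhase t r σ * (Complex.I * (2 * t) * ((σ - r / (2 * t) : ℝ) : ℂ))) σ := by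
  have ht' : (t : ℂ) ≠ 0 := by exact_mod_cast ht.ne'
  have h0 : HasDerivAt (fun z : ℂ => Complex.I * (z ^ 2 * t - z * r))
      (Complex.I * (2 * t) * ((σ - r / (2 * t) : ℝ) : ℂ)) (σ : ℂ) := by
    refine ((((hasDerivAt_id (σ : ℂ)).pow 2).mul_const (t : ℂ)).sub
      ((hasDerivAt_id (σ : ℂ)).mul_const (r : ℂ))).const_mul Complex.I |>.congr_deriv ?_
    push_cast
    simp only [id]
    field_simp
  exact h0.cexp.comp_ofReal

/-- The integrand with amplitude `(σ - r/(2t))^{-m} u(σ - r/(2t)) φ(σ)`. -/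
noncomputable def phaseIntegrand (t r : ℝ) (m : ℕ) (u : ℝ → ℂ) (φ : SchwartzMap ℝ ℂ) (σ : ℝ) : ℂ :=
  quadraticPhase t r σ *
    (((σ - r / (2 * t) : ℝ) : ℂ)⁻¹ ^ m * u (σ - r / (2 * t))) * φ σ

theorem integrable_phaseIntegrand {δ : ℝ} {u : ℝ → ℂ} (hδ : 0 < δ) (hu : IsCutoffAway δ u)
    (t r : ℝ) (m : ℕ) (φ : SchwartzMap ℝ ℂ) : Integrable (phaseIntegrand t r m u φ) := by
  obtain ⟨C, -, hC⟩ := hu.norm_inv_pow_mul_le hδ m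
  have hm : Measurable u := hu.contDiff.continuous.measurable
  refine ((φ.integrable (μ := volume)).norm.const_mul C).mono' ?_ (.of_forall fun σ => ?_)
  · refine Measurable.aestronglyMeasurable ?_
    have := φ.continuous.measurable
    unfold phaseIntegrand quadraticPhase
    fun_prop
  · rw [phaseIntegrand, norm_mul, norm_mul, norm_quadraticPhase, one_mul]
    gcongr
    exact hC _

theorem integral_phaseIntegrand_by_parts {δ : ℝ} {u : ℝ → ℂ} (hδ : 0 < δ)
    (hu : IsCutoffAway δ u) {t : ℝ} (ht : 0 < t) (r : ℝ) (m : ℕ) (φ : SchwartzMap ℝ ℂ) :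
    Complex.I * (2 * t) * ∫ σ, phaseIntegrand t r m u φ σ =
      (m + 1) * (∫ σ, phaseIntegrand t r (m + 2) u φ σ) -
      (∫ σ, phaseIntegrand t r (m + 1) (deriv u) φ σ) -
      ∫ σ, phaseIntegrand t r (m + 1) u (SchwartzMap.derivCLM ℂ ℂ φ) σ := by
  have i1 := (integrable_phaseIntegrand hδ hu t r m φ).const_mul (Complex.I * (2 * t))
  have i2 := (integrable_phaseIntegrand hδ hu t r (m + 2) φ).const_mul (m + 1 : ℂ)
  have i3 := integrable_phaseIntegrand hδ hu.deriv t r (m + 1) φ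
  have i4 := integrable_phaseIntegrand hδ hu t r (m + 1) (SchwartzMap.derivCLM ℂ ℂ φ)
  have i12 : Integrable fun σ => Complex.I * (2 * t) * phaseIntegrand t r m u φ σ -
      (m + 1) * phaseIntegrand t r (m + 2) u φ σ := i1.sub i2
  have i123 : Integrable fun σ => Complex.I * (2 * t) * phaseIntegrand t r m u φ σ -
      (m + 1) * phaseIntegrand t r (m + 2) u φ σ +
      phaseIntegrand t r (m + 1) (deriv u) φ σ := i12.add i3
  have key := integral_eq_zero_of_hasDerivAt_of_integrable
    (f := phaseIntegrand t r (m + 1) u φ)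
    (f' := fun σ => Complex.I * (2 * t) * phaseIntegrand t r m u φ σ -
      (m + 1) * phaseIntegrand t r (m + 2) u φ σ +
      phaseIntegrand t r (m + 1) (deriv u) φ σ +
      phaseIntegrand t r (m + 1) u (SchwartzMap.derivCLM ℂ ℂ φ) σ) ?_
    (i123.add i4) (integrable_phaseIntegrand hδ hu t r (m + 1) φ)
  · rw [integral_add i123 i4, integral_add i12 i3,
      integral_sub i1 i2, integral_const_mul, integral_const_mul] at key
    linear_combination key
  · intro σ
    have hw := (hu.hasDerivAt_inv_pow_mul hδ (m + 1) (σ - r / (2 * t))).comp_sub_const σ (r / (2 * t))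
    have h := ((hasDerivAt_quadraticPhase ht r σ).mul hw).mul φ.differentiableAt.hasDerivAt
    refine h.congr_deriv ?_
    simp only [phaseIntegrand, SchwartzMap.derivCLM_apply, Pi.mul_apply]
    generalize hx : σ - r / (2 * t) = x
    have hcancel : (x : ℂ) * ((x : ℂ)⁻¹ ^ (m + 1) * u x) = (x : ℂ)⁻¹ ^ m * u x := by
      rcases eq_or_ne x 0 with rfl | hx0
      · rw [hu.vanish 0 (by simpa using hδ)]
        simp
      · have : (x : ℂ) ≠ 0 := by exact_mod_cast hx0
        linear_combination ((x : ℂ)⁻¹ ^ m * u x) * mul_inv_cancel₀ this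
    push_cast
    linear_combination
      (quadraticPhase t r σ * Complex.I * (2 * t) * φ σ) * hcancel

/-- Away from the stationary point, the phase derivative `2σt - r` is bounded below. -/
theorem exists_le_mul_abs_phase_deriv {σ₀ δ r₀ : ℝ} (hσ₀ : 0 < σ₀) (hδ : 0 < δ) (hr₀ : 0 < r₀) :
    ∃ A, 0 ≤ A ∧ ∀ t r σ : ℝ, 0 < t → r₀ ≤ r → σ₀ ≤ σ → δ ≤ |σ - r / (2 * t)| →
      1 + t + r ≤ A * (1 + ‖σ‖) * (2 * t * |σ - r / (2 * t)|) := by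
  refine ⟨2 * (1 / r₀ + 1 / (4 * σ₀) + 1) + (4 / r₀ + 5) / (2 * δ), by positivity,
    fun t r σ ht hr hσ hx => ?_⟩
  have hσp : 0 < σ := hσ₀.trans_le hσ
  have hrp : 0 < r := hr₀.trans_le hr
  rw [Real.norm_of_nonneg hσp.le]
  rcases le_total (4 * t * σ) r with h | h
  · have h1 : r / 2 ≤ 2 * t * |σ - r / (2 * t)| := by
      have : 2 * t * (σ - r / (2 * t)) = 2 * t * σ - r := by field_simp
      have h2 := neg_abs_le (σ - r / (2 * t))
      nlinarith
    have h2 : 1 ≤ 1 / r₀ * r := by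
      rw [one_div_mul_eq_div, le_div_iff₀ hr₀]; linarith
    have h3 : t ≤ 1 / (4 * σ₀) * r := by
      rw [one_div_mul_eq_div, le_div_iff₀ (by positivity)]; nlinarith
    calc 1 + t + r ≤ 2 * (1 / r₀ + 1 / (4 * σ₀) + 1) * 1 * (r / 2) := by linarith
      _ ≤ _ := by
        gcongr
        · exact le_add_of_nonneg_right (by positivity)
        · linarith
  · have h2 : 1 ≤ 4 / r₀ * (t * σ) := by
      rw [div_mul_eq_mul_div, le_div_iff₀ hr₀]; linarith
    have h3 : 0 ≤ 4 / r₀ * t := by positivity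
    calc 1 + t + r ≤ (4 / r₀ + 5) / (2 * δ) * (1 + σ) * (2 * t * δ) := by
          have : (4 / r₀ + 5) / (2 * δ) * (1 + σ) * (2 * t * δ)
            = (4 / r₀ + 5) * (1 + σ) * t := by field_simp
          rw [this]
          nlinarith [mul_pos ht hσp]
      _ ≤ _ := by
        gcongr
        exact le_add_of_nonneg_left (by positivity)

theorem integrable_one_add_norm_pow_mul (φ : SchwartzMap ℝ ℂ) (k : ℕ) :
    Integrable fun σ : ℝ => (1 + ‖σ‖) ^ k * ‖φ σ‖ := by
  have hφ := φ.continuous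
  refine (((φ.integrable_pow_mul volume 0).add (φ.integrable_pow_mul volume k)).const_mul
    (2 ^ (k - 1))).mono' (by fun_prop) (.of_forall fun σ => ?_)
  rw [Real.norm_of_nonneg (by positivity)]
  have := add_pow_le zero_le_one (norm_nonneg σ) k
  calc (1 + ‖σ‖) ^ k * ‖φ σ‖ ≤ 2 ^ (k - 1) * (1 ^ k + ‖σ‖ ^ k) * ‖φ σ‖ := by gcongr
    _ = _ := by simp; ring

theorem exists_integral_phaseIntegrand_le {σ₀ δ r₀ : ℝ} (hσ₀ : 0 < σ₀) (hδ : 0 < δ)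
    (hr₀ : 0 < r₀) (m k : ℕ) {u : ℝ → ℂ} (hu : IsCutoffAway δ u) (φ : SchwartzMap ℝ ℂ)
    (hφ : ∀ σ < σ₀, φ σ = 0) :
    ∃ C, ∀ t r : ℝ, 0 < t → r₀ ≤ r →
      (1 + t + r) ^ k * ‖∫ σ, phaseIntegrand t r (m + k) u φ σ‖ ≤ C * (2 * t) ^ k := by
  obtain ⟨A, hA, hbound⟩ := exists_le_mul_abs_phase_deriv hσ₀ hδ hr₀
  obtain ⟨B, hB, hu_le⟩ := hu.norm_inv_pow_mul_le hδ m
  refine ⟨A ^ k * B * ∫ σ, (1 + ‖σ‖) ^ k * ‖φ σ‖, fun t r ht hr => ?_⟩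
  have hpos : 0 < 1 + t + r := by linarith
  have hcoe : (1 + t + r) ^ k * ‖∫ σ, phaseIntegrand t r (m + k) u φ σ‖ =
      ‖∫ σ, ((1 + t + r : ℝ) : ℂ) ^ k * phaseIntegrand t r (m + k) u φ σ‖ := by
    rw [integral_const_mul, norm_mul, norm_pow, Complex.norm_real, Real.norm_of_nonneg hpos.le]
  have hC : A ^ k * B * (∫ σ, (1 + ‖σ‖) ^ k * ‖φ σ‖) * (2 * t) ^ k =
      ∫ σ, A ^ k * B * (2 * t) ^ k * ((1 + ‖σ‖) ^ k * ‖φ σ‖) := by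
    rw [integral_const_mul]; ring
  rw [hcoe, hC]
  refine norm_integral_le_of_norm_le ((integrable_one_add_norm_pow_mul φ k).const_mul _)
    (.of_forall fun σ => ?_)
  rw [phaseIntegrand, norm_mul, norm_mul, norm_mul, norm_quadraticPhase, norm_pow,
    Complex.norm_real, Real.norm_of_nonneg hpos.le, one_mul]
  rcases lt_or_ge σ σ₀ with hσ | hσ
  · simp [hφ σ hσ]
  have hxu := hu_le (σ - r / (2 * t))
  have hb := hbound t r σ ht hr hσ
  have hv := hu.vanish (σ - r / (2 * t))
  generalize σ - r / (2 * t) = x at *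
  rcases lt_or_ge |x| δ with hx | hx
  · rw [hv hx, mul_zero, norm_zero]
    simp only [zero_mul, mul_zero]
    positivity
  · have hx0 : 0 < |x| := hδ.trans_le hx
    rw [pow_add, mul_right_comm, norm_mul, norm_pow (x : ℂ)⁻¹ k, norm_inv, Complex.norm_real,
      Real.norm_eq_abs]
    calc (1 + t + r) ^ k * (‖(x : ℂ)⁻¹ ^ m * u x‖ * |x|⁻¹ ^ k * ‖φ σ‖)
        ≤ (A * (1 + ‖σ‖) * (2 * t * |x|)) ^ k * (B * |x|⁻¹ ^ k * ‖φ σ‖) := by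
          gcongr
          exact hb hx
      _ = _ := by
          simp only [mul_pow, inv_pow]
          field_simp

theorem exists_integral_phaseIntegrand_le_of_decay {σ₀ δ r₀ : ℝ} (hσ₀ : 0 < σ₀) (hδ : 0 < δ)
    (hr₀ : 0 < r₀) (j : ℕ) : ∀ (m k : ℕ) (u : ℝ → ℂ), IsCutoffAway δ u →
    ∀ φ : SchwartzMap ℝ ℂ, (∀ σ < σ₀, φ σ = 0) →
    ∃ C, ∀ t r : ℝ, 0 < t → r₀ ≤ r →
      (1 + t + r) ^ (k + j) * ‖∫ σ, phaseIntegrand t r (m + k) u φ σ‖ ≤ C * (2 * t) ^ k := by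
  induction j with
  | zero =>
    intro m k u hu φ hφ
    exact exists_integral_phaseIntegrand_le hσ₀ hδ hr₀ m k hu φ hφ
  | succ j ih =>
    intro m k u hu φ hφ
    have hφ' : ∀ σ < σ₀, SchwartzMap.derivCLM ℂ ℂ φ σ = 0 := by
      intro σ hσ
      have h : φ =ᶠ[𝓝 σ] fun _ => 0 := by
        filter_upwards [Iio_mem_nhds hσ] with y hy using hφ y hy
      rw [SchwartzMap.derivCLM_apply, h.deriv_eq, deriv_const]
    obtain ⟨C₁, h₁⟩ := ih (m + 1) (k + 1) u hu φ hφ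
    obtain ⟨C₂, h₂⟩ := ih m (k + 1) (deriv u) hu.deriv φ hφ
    obtain ⟨C₃, h₃⟩ := ih m (k + 1) u hu _ hφ'
    refine ⟨(m + k + 1) * C₁ + C₂ + C₃, fun t r ht hr => ?_⟩
    have hpos : 0 < 1 + t + r := by linarith
    have e := integral_phaseIntegrand_by_parts hδ hu ht r (m + k) φ
    replace h₁ := h₁ t r ht hr
    replace h₂ := h₂ t r ht hr
    replace h₃ := h₃ t r ht hr
    rw [show m + 1 + (k + 1) = m + k + 2 by ring] at h₁
    rw [← add_assoc m k 1] at h₂ h₃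
    have hn : 2 * t * ‖∫ σ, phaseIntegrand t r (m + k) u φ σ‖ ≤
        (m + k + 1) * ‖∫ σ, phaseIntegrand t r (m + k + 2) u φ σ‖ +
        ‖∫ σ, phaseIntegrand t r (m + k + 1) (deriv u) φ σ‖ +
        ‖∫ σ, phaseIntegrand t r (m + k + 1) u (SchwartzMap.derivCLM ℂ ℂ φ) σ‖ := by
      have hl : 2 * t * ‖∫ σ, phaseIntegrand t r (m + k) u φ σ‖ =
          ‖Complex.I * (2 * t) * ∫ σ, phaseIntegrand t r (m + k) u φ σ‖ := by
        simp [abs_of_pos ht]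
      have hc : ‖(((m + k : ℕ) : ℂ) + 1)‖ = m + k + 1 := by
        exact_mod_cast Complex.norm_natCast (m + k + 1)
      rw [hl, e, ← hc, ← norm_mul]
      exact (norm_sub_le _ _).trans (add_le_add_left (norm_sub_le _ _) _)
    have ht2 : 0 < 2 * t := by positivity
    refine le_of_mul_le_mul_left ?_ ht2
    rw [show k + (j + 1) = k + 1 + j by ring]
    calc 2 * t * ((1 + t + r) ^ (k + 1 + j) * ‖∫ σ, phaseIntegrand t r (m + k) u φ σ‖)
        = (1 + t + r) ^ (k + 1 + j) * (2 * t * ‖∫ σ, phaseIntegrand t r (m + k) u φ σ‖) := by ring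
      _ ≤ _ := mul_le_mul_of_nonneg_left hn (by positivity)
      _ = (m + k + 1) * ((1 + t + r) ^ (k + 1 + j) *
            ‖∫ σ, phaseIntegrand t r (m + k + 2) u φ σ‖) +
          (1 + t + r) ^ (k + 1 + j) *
            ‖∫ σ, phaseIntegrand t r (m + k + 1) (deriv u) φ σ‖ +
          (1 + t + r) ^ (k + 1 + j) *
            ‖∫ σ, phaseIntegrand t r (m + k + 1) u (SchwartzMap.derivCLM ℂ ℂ φ) σ‖ := by ring
      _ ≤ (m + k + 1) * (C₁ * (2 * t) ^ (k + 1)) + C₂ * (2 * t) ^ (k + 1) +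
          C₃ * (2 * t) ^ (k + 1) := by gcongr
      _ = _ := by ring

/-- Let `σ₀ > 0`, `φ` Schwartz vanishing on `(-∞, σ₀]`, and
`ψ ∈ C_c^∞(ℝ)` identically `1` near `0` with support in `(-σ₀, σ₀)`. For every `K ∈ ℕ` and
`r₀ > 0` there is `C > 0` such that for all `t > 0` and `r ≥ r₀`:
`|∫_0^∞ e^{i(σ²t - σr)} (1 - ψ(σ - r/(2t))) φ(σ) dσ| ≤ C (1+t+r)^{-K}`. -/
theorem stmt11 (σ₀ : ℝ) (hσ₀ : 0 < σ₀) (φ : SchwartzMap ℝ ℂ)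
    (hvan : ∀ σ : ℝ, σ ≤ σ₀ → φ σ = 0)
    (ψ : ℝ → ℂ) (hψs : ContDiff ℝ (⊤ : ℕ∞) ψ) (hψc : HasCompactSupport ψ)
    (hψ1 : ∀ᶠ x in 𝓝 (0 : ℝ), ψ x = 1) (hψsupp : tsupport ψ ⊆ Ioo (-σ₀) σ₀)
    (K : ℕ) (r₀ : ℝ) (hr₀ : 0 < r₀) :
    ∃ C > 0, ∀ t : ℝ, 0 < t → ∀ r : ℝ, r₀ ≤ r →
      ‖∫ σ in Ioi (0 : ℝ),
          Complex.exp (Complex.I * (σ ^ 2 * t - σ * r)) * (1 - ψ (σ - r / (2 * t))) * φ σ‖ ≤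
        C / (1 + t + r) ^ K := by
  obtain ⟨δ, hδ, hδ1⟩ := Metric.eventually_nhds_iff.1 hψ1
  have hu : IsCutoffAway δ fun x => 1 - ψ x := by
    refine ⟨contDiff_const.sub hψs, ?_, ?_, fun x hx => ?_⟩
    · obtain ⟨C, hC⟩ := hψc.exists_bound_of_continuous hψs.continuous
      refine ⟨1 + C, fun x => (norm_sub_le _ _).trans ?_⟩
      rw [norm_one]
      gcongr
      exact hC x
    · have : deriv (fun x => 1 - ψ x) = -deriv ψ := by
        ext x
        simp
      rw [this]
      exact hψc.deriv.neg
    · rw [hδ1 (by simpa using hx), sub_self]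
  obtain ⟨C, hC⟩ := exists_integral_phaseIntegrand_le_of_decay hσ₀ hδ hr₀ K 0 0 _ hu φ
    fun σ hσ => hvan σ hσ.le
  refine ⟨max C 1, by positivity, fun t ht r hr => ?_⟩
  have hpos : 0 < 1 + t + r := by linarith
  rw [setIntegral_eq_integral_of_forall_compl_eq_zero fun σ hσ => by
    rw [hvan σ ((not_lt.1 hσ).trans hσ₀.le), mul_zero]]
  rw [le_div_iff₀ (by positivity), mul_comm]
  have h := hC t r ht hr
  simp only [zero_add, phaseIntegrand, quadraticPhase, pow_zero, one_mul, mul_one] at h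
  exact h.trans (le_max_left _ _)
end
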